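/- (Dual representation of the exponentially tilted empirical likelihood weights.) Let g₁,…,g_n ∈ ℝ^m and assume 0 lies in the interior of the convex hull of {g₁,…,g_n}. Then the problem maximize Σ_{i=1}^n [−p_i log(n p_i)] over (p₁,…,p_n) subject to p_i ≥ 0, Σ_{i=1}^n p_i = 1 and Σ_{i=1}^n p_i g_i = 0 has a unique solution, and this solution is given by p̂_i = e^{⟨λ̂,g_i⟩}/Σ_{j=1}^n e^{⟨λ̂,g_j⟩}, i = 1,…,n, where λ̂ is any minimizer of λ ↦ (1/n)Σ_{i=1}^n e^{⟨λ,g_i⟩} over ℝ^m (such a minimizer exists, and the resulting probabilities do not depend on the choice of minimizer). -/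

import Mathlib

open MeasureTheory Filter Set
open scoped ENNReal Topology RealInnerProductSpace BigOperators

noncomputable section

theorem etel_aux_min {n m : ℕ}
    (g : Fin n → EuclideanSpace ℝ (Fin m))
    (h0 : (0 : EuclideanSpace ℝ (Fin m)) ∈ interior (convexHull ℝ (Set.range g))) :
    ∃ lam : EuclideanSpace ℝ (Fin m), ∀ l,
      ∑ i, Real.exp ⟪lam, g i⟫ ≤ ∑ i, Real.exp ⟪l, g i⟫ := by
  obtain ⟨r, hr, hball⟩ := Metric.nhds_basis_closedBall.mem_iff.1 (mem_interior_iff_mem_nhds.1 h0)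
  have key : ∀ l : EuclideanSpace ℝ (Fin m), r * ‖l‖ ≤ ∑ i, Real.exp ⟪l, g i⟫ := by
    intro l
    by_cases hl : l = 0
    · subst hl
      simp
    have hl' : 0 < ‖l‖ := norm_pos_iff.2 hl
    have hmem : (r / ‖l‖) • l ∈ convexHull ℝ (Set.range g) := by
      apply hball
      rw [mem_closedBall_zero_iff, norm_smul, Real.norm_of_nonneg (by positivity)]
      field_simp
      exact le_refl _
    have hex : ∃ i, r * ‖l‖ ≤ ⟪l, g i⟫ := by
      by_contra! hcon
      have hconv : Convex ℝ {x : EuclideanSpace ℝ (Fin m) | ⟪l, x⟫ < r * ‖l‖} :=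
        convex_halfSpace_lt (innerSL ℝ l).toLinearMap.isLinear _
      have hsub : convexHull ℝ (Set.range g) ⊆ {x | ⟪l, x⟫ < r * ‖l‖} := by
        apply convexHull_min _ hconv
        rintro _ ⟨i, rfl⟩
        exact hcon i
      have h1 := hsub hmem
      rw [Set.mem_setOf_eq, inner_smul_right, real_inner_self_eq_norm_sq] at h1
      have h2 : r / ‖l‖ * ‖l‖ ^ 2 = r * ‖l‖ := by field_simp
      linarith
    obtain ⟨i, hi⟩ := hex
    have h3 : Real.exp ⟪l, g i⟫ ≤ ∑ i, Real.exp ⟪l, g i⟫ :=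
      Finset.single_le_sum (f := fun i => Real.exp ⟪l, g i⟫)
        (fun j _ => (Real.exp_pos _).le) (Finset.mem_univ i)
    have h4 := Real.add_one_le_exp ⟪l, g i⟫
    linarith
  have hc : Continuous fun l : EuclideanSpace ℝ (Fin m) => ∑ i, Real.exp ⟪l, g i⟫ := by
    fun_prop
  apply hc.exists_forall_le
  exact tendsto_atTop_mono key (tendsto_norm_cocompact_atTop.const_mul_atTop hr)

theorem etel_aux_foc {n m : ℕ}
    (g : Fin n → EuclideanSpace ℝ (Fin m)) (lam : EuclideanSpace ℝ (Fin m))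
    (h : ∀ l, ∑ i, Real.exp ⟪lam, g i⟫ ≤ ∑ i, Real.exp ⟪l, g i⟫) :
    ∑ i, Real.exp ⟪lam, g i⟫ • g i = 0 := by
  set v := ∑ i, Real.exp ⟪lam, g i⟫ • g i with hv
  have hd : HasDerivAt (fun t : ℝ => ∑ i, Real.exp (⟪lam, g i⟫ + t * ⟪v, g i⟫))
      (∑ i, Real.exp (⟪lam, g i⟫ + 0 * ⟪v, g i⟫) * (1 * ⟪v, g i⟫)) 0 := by
    apply HasDerivAt.fun_sum
    intro i _
    exact (((hasDerivAt_id (0 : ℝ)).mul_const ⟪v, g i⟫).const_add ⟪lam, g i⟫).exp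
  have hmin : IsLocalMin (fun t : ℝ => ∑ i, Real.exp (⟪lam, g i⟫ + t * ⟪v, g i⟫)) 0 := by
    apply Filter.Eventually.of_forall
    intro t
    have := h (lam + t • v)
    simpa [inner_add_left, inner_smul_left] using this
  have h1 := hmin.hasDerivAt_eq_zero hd
  have h2 : ⟪v, v⟫ = 0 := by
    conv_lhs => rw [hv]
    rw [← hv, ← h1]
    conv_lhs => arg 3; rw [hv]
    rw [inner_sum]
    apply Finset.sum_congr rfl
    intro i _
    simp [inner_smul_right]
  exact inner_self_eq_zero.1 h2

theorem etel_aux_pt {N p q : ℝ} (hN : 0 < N) (hp : 0 ≤ p) (hq : 0 < q) :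
    p - q ≤ p * Real.log (N * p) - p * Real.log (N * q) ∧
    (p ≠ q → p - q < p * Real.log (N * p) - p * Real.log (N * q)) := by
  rcases hp.eq_or_lt with rfl | hp
  · simp [hq, hq.le]
  rw [Real.log_mul hN.ne' hp.ne', Real.log_mul hN.ne' hq.ne']
  have e : Real.log (q / p) = Real.log q - Real.log p := Real.log_div hq.ne' hp.ne'
  have e2 : p * (q / p - 1) = q - p := by field_simp
  constructor
  · have h1 := mul_le_mul_of_nonneg_left (Real.log_le_sub_one_of_pos (div_pos hq hp)) hp.le
    rw [e, e2] at h1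
    linarith
  · intro hne
    have hne' : q / p ≠ 1 := by
      rw [Ne, div_eq_one_iff_eq hp.ne']
      exact hne.symm
    have h1 := mul_lt_mul_of_pos_left (Real.log_lt_sub_one_of_pos (div_pos hq hp) hne') hp
    rw [e, e2] at h1
    linarith

theorem etel_aux_main {n m : ℕ} (hn : 0 < n)
    (g : Fin n → EuclideanSpace ℝ (Fin m)) (lam : EuclideanSpace ℝ (Fin m))
    (h : ∀ l, ∑ i, Real.exp ⟪lam, g i⟫ ≤ ∑ i, Real.exp ⟪l, g i⟫)
    (Q : Fin n → ℝ) (hQ : Q = fun i => Real.exp ⟪lam, g i⟫ / ∑ j, Real.exp ⟪lam, g j⟫) :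
    ((∀ i, 0 ≤ Q i) ∧ ∑ i, Q i = 1 ∧ ∑ i, Q i • g i = 0) ∧
    ∀ P : Fin n → ℝ, ((∀ i, 0 ≤ P i) ∧ ∑ i, P i = 1 ∧ ∑ i, P i • g i = 0) → P ≠ Q →
      ∑ i, -(P i * Real.log (n * P i)) < ∑ i, -(Q i * Real.log (n * Q i)) := by
  have hfoc := etel_aux_foc g lam h
  have hnR : (0 : ℝ) < n := by exact_mod_cast hn
  set S := ∑ j, Real.exp ⟪lam, g j⟫ with hS
  have hSpos : 0 < S := by
    apply Finset.sum_pos (fun i _ => Real.exp_pos _)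
    exact ⟨⟨0, hn⟩, Finset.mem_univ _⟩
  have hQpos : ∀ i, 0 < Q i := by
    intro i
    rw [hQ]
    exact div_pos (Real.exp_pos _) hSpos
  have hQf : (∀ i, 0 ≤ Q i) ∧ ∑ i, Q i = 1 ∧ ∑ i, Q i • g i = 0 := by
    refine ⟨fun i => (hQpos i).le, ?_, ?_⟩
    · rw [hQ, ← Finset.sum_div, ← hS, div_self hSpos.ne']
    · have : ∀ i, Q i • g i = S⁻¹ • (Real.exp ⟪lam, g i⟫ • g i) := by
        intro i
        rw [hQ, smul_smul]
        congr 1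
        field_simp
      simp_rw [this]
      rw [← Finset.smul_sum, hfoc, smul_zero]
  have hlin : ∀ P : Fin n → ℝ, ((∀ i, 0 ≤ P i) ∧ ∑ i, P i = 1 ∧ ∑ i, P i • g i = 0) →
      ∑ i, P i * Real.log (n * Q i) = Real.log n - Real.log S := by
    rintro P ⟨-, hP1, hP0⟩
    have hlog : ∀ i, P i * Real.log (n * Q i)
        = P i * (Real.log n - Real.log S) + ⟪lam, P i • g i⟫ := by
      intro i
      rw [Real.log_mul hnR.ne' (hQpos i).ne', inner_smul_right, hQ]
      simp only
      rw [Real.log_div (Real.exp_pos _).ne' hSpos.ne', Real.log_exp]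
      ring
    simp_rw [hlog]
    rw [Finset.sum_add_distrib, ← Finset.sum_mul, ← inner_sum, hP1, hP0, inner_zero_right]
    ring
  refine ⟨hQf, ?_⟩
  intro P hP hne
  obtain ⟨k, hk⟩ := Function.ne_iff.1 hne
  have hlt : ∑ i, (P i - Q i) < ∑ i, (P i * Real.log (n * P i) - P i * Real.log (n * Q i)) :=
    Finset.sum_lt_sum (fun i _ => (etel_aux_pt hnR (hP.1 i) (hQpos i)).1)
      ⟨k, Finset.mem_univ _, (etel_aux_pt hnR (hP.1 k) (hQpos k)).2 hk⟩
  rw [Finset.sum_sub_distrib, Finset.sum_sub_distrib, hlin P hP, hP.2.1, hQf.2.1] at hlt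
  rw [Finset.sum_neg_distrib, Finset.sum_neg_distrib, hlin Q hQf]
  linarith

/-- **Dual (saddlepoint) representation of the ETEL weights.**
If `0` lies in the interior of the convex hull of `g₁, …, gₙ ∈ ℝ^m`, then the problem of
maximizing `∑ᵢ -pᵢ log(n pᵢ)` over probability vectors `p` with `∑ᵢ pᵢ gᵢ = 0` has a
unique solution, the minimizer of `λ ↦ (1/n) ∑ᵢ exp⟪λ, gᵢ⟫` exists, and for any such
minimizer `λ̂` the solution is `p̂ᵢ = exp⟪λ̂, gᵢ⟫ / ∑ⱼ exp⟪λ̂, gⱼ⟫` (so the resulting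
probabilities do not depend on the choice of minimizer). -/
theorem etel_dual_representation {n m : ℕ} (hn : 0 < n)
    (g : Fin n → EuclideanSpace ℝ (Fin m))
    (h0 : (0 : EuclideanSpace ℝ (Fin m)) ∈ interior (convexHull ℝ (Set.range g))) :
    (∃ lam : EuclideanSpace ℝ (Fin m), ∀ l,
      (n : ℝ)⁻¹ * ∑ i, Real.exp ⟪lam, g i⟫ ≤ (n : ℝ)⁻¹ * ∑ i, Real.exp ⟪l, g i⟫) ∧
    (∃! P : Fin n → ℝ,
      ((∀ i, 0 ≤ P i) ∧ ∑ i, P i = 1 ∧ ∑ i, P i • g i = 0) ∧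
        ∀ P' : Fin n → ℝ,
          ((∀ i, 0 ≤ P' i) ∧ ∑ i, P' i = 1 ∧ ∑ i, P' i • g i = 0) →
            ∑ i, -(P' i * Real.log (n * P' i)) ≤ ∑ i, -(P i * Real.log (n * P i))) ∧
    ∀ lam : EuclideanSpace ℝ (Fin m),
      (∀ l, (n : ℝ)⁻¹ * ∑ i, Real.exp ⟪lam, g i⟫ ≤ (n : ℝ)⁻¹ * ∑ i, Real.exp ⟪l, g i⟫) →
      ∀ P : Fin n → ℝ,
        (((∀ i, 0 ≤ P i) ∧ ∑ i, P i = 1 ∧ ∑ i, P i • g i = 0) ∧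
          ∀ P' : Fin n → ℝ,
            ((∀ i, 0 ≤ P' i) ∧ ∑ i, P' i = 1 ∧ ∑ i, P' i • g i = 0) →
              ∑ i, -(P' i * Real.log (n * P' i)) ≤ ∑ i, -(P i * Real.log (n * P i))) →
        ∀ i, P i = Real.exp ⟪lam, g i⟫ / ∑ j, Real.exp ⟪lam, g j⟫ := by
  have hnR : (0 : ℝ) < (n : ℝ)⁻¹ := by
    have : (0 : ℝ) < n := by exact_mod_cast hn
    positivity
  simp only [mul_le_mul_iff_right₀ hnR]
  obtain ⟨lam, hlam⟩ := etel_aux_min g h0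
  refine ⟨⟨lam, hlam⟩, ?_, ?_⟩
  · obtain ⟨hf, hopt⟩ := etel_aux_main hn g lam hlam _ rfl
    refine ⟨_, ⟨hf, ?_⟩, ?_⟩
    · intro P' hP'
      by_cases he : P' = fun i => Real.exp ⟪lam, g i⟫ / ∑ j, Real.exp ⟪lam, g j⟫
      · rw [he]
      · exact (hopt P' hP' he).le
    · rintro P ⟨hP, hPo⟩
      by_contra he
      exact absurd (hPo _ hf) (not_le.2 (hopt P hP he))
  · rintro lam' hlam' P ⟨hP, hPo⟩
    obtain ⟨hf, hopt⟩ := etel_aux_main hn g lam' hlam' _ rfl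
    refine congrFun (?_ : P = fun i => Real.exp ⟪lam', g i⟫ / ∑ j, Real.exp ⟪lam', g j⟫)
    by_contra he
    exact absurd (hPo _ hf) (not_le.2 (hopt P hP he))

end
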